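/- Let a, b ∈ ℂ[u,v] ⊆ ℂ[x,y,u,v] be homogeneous polynomials of degree 3 having no common zero in ℂ² ∖ {0}, and let I = (a·x + b·y, x², x·y, y²) ⊆ R = ℂ[x,y,u,v]. Then every homogeneous element of I of degree at most 3 belongs to the ideal (x², x·y, y²), while a·x + b·y does not belong to (x², x·y, y²); in particular, I is strictly larger than the ideal generated by its homogeneous elements of degree at most 3. (This expresses that the twisted ideal sheaf I_Z(2) of the double line Z is not globally generated.) -/

import Mathlib

open MvPolynomial

/-- Variables: `x = X 0`, `y = X 1`, `u = X 2`, `v = X 3`; `ℂ[u,v] ⊆ ℂ[x,y,u,v]`. -/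
noncomputable def embUV : MvPolynomial (Fin 2) ℂ →ₐ[ℂ] MvPolynomial (Fin 4) ℂ :=
  MvPolynomial.rename (fun i : Fin 2 => (i.succ.succ : Fin 4))

/-- Multiples of a homogeneous polynomial of degree `n` have no terms of degree below `n`. -/
theorem MvPolynomial.IsHomogeneous.coeff_mul_eq_zero_of_degree_lt {σ R : Type*} [CommSemiring R]
    {g : MvPolynomial σ R} {n : ℕ} (hg : g.IsHomogeneous n) (q : MvPolynomial σ R) {m : σ →₀ ℕ}
    (hm : m.degree < n) : coeff m (q * g) = 0 := by
  classical
  rw [coeff_mul]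
  refine Finset.sum_eq_zero fun p hp => ?_
  rw [Finset.HasAntidiagonal.mem_antidiagonal] at hp
  rw [hg.coeff_eq_zero, mul_zero]
  have h := congrArg Finsupp.degree hp
  rw [map_add] at h
  omega

/-- The ideal `(x², x·y, y²)` is a monomial ideal. -/
theorem exists_span_sq_eq_span_monomial : ∃ S : Set (Fin 4 →₀ ℕ),
    Ideal.span ({X 0 ^ 2, X 0 * X 1, X 1 ^ 2} : Set (MvPolynomial (Fin 4) ℂ)) =
      Ideal.span ((fun s => monomial s (1 : ℂ)) '' S) := by
  refine ⟨{Finsupp.single 0 2, Finsupp.single 0 1 + Finsupp.single 1 1, Finsupp.single 1 2}, ?_⟩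
  have h : (monomial (Finsupp.single 0 1 + Finsupp.single 1 1) 1 : MvPolynomial (Fin 4) ℂ) =
      X 0 * X 1 := by
    simp [X, monomial_mul]
  simp only [Set.image_insert_eq, Set.image_singleton, h, X_pow_eq_monomial]

/-- Membership in `(x², x·y, y²)` passes to any polynomial whose support is smaller. -/
theorem mem_span_sq_of_support_subset {f j : MvPolynomial (Fin 4) ℂ}
    (hj : j ∈ Ideal.span ({X 0 ^ 2, X 0 * X 1, X 1 ^ 2} : Set (MvPolynomial (Fin 4) ℂ)))
    (h : f.support ⊆ j.support) :
    f ∈ Ideal.span ({X 0 ^ 2, X 0 * X 1, X 1 ^ 2} : Set (MvPolynomial (Fin 4) ℂ)) := by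
  obtain ⟨S, hS⟩ := exists_span_sq_eq_span_monomial
  rw [hS, mem_ideal_span_monomial_image] at hj ⊢
  exact fun m hm => hj m (h hm)

/-- First-order deformation in the direction `(s, t)` of the point `p` of the line `x = y = 0`. -/
noncomputable def normalJet (p : Fin 2 → ℂ) (s t : ℂ) :
    MvPolynomial (Fin 4) ℂ →ₐ[ℂ] DualNumber ℂ :=
  aeval ![TrivSqZeroExt.inr s, TrivSqZeroExt.inr t,
    algebraMap ℂ (DualNumber ℂ) (p 0), algebraMap ℂ (DualNumber ℂ) (p 1)]

theorem normalJet_embUV (p : Fin 2 → ℂ) (s t : ℂ) (a : MvPolynomial (Fin 2) ℂ) :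
    normalJet p s t (embUV a) = algebraMap ℂ (DualNumber ℂ) (eval p a) := by
  have h : (normalJet p s t).comp embUV = (Algebra.ofId ℂ (DualNumber ℂ)).comp (aeval p) := by
    ext i : 1
    fin_cases i <;> simp [normalJet, embUV, Algebra.ofId_apply]
  simpa [Algebra.ofId_apply, coe_aeval_eq_eval] using DFunLike.congr_fun h a

theorem normalJet_eq_zero_of_mem_span_sq (p : Fin 2 → ℂ) (s t : ℂ) {f : MvPolynomial (Fin 4) ℂ}
    (hf : f ∈ Ideal.span ({X 0 ^ 2, X 0 * X 1, X 1 ^ 2} : Set (MvPolynomial (Fin 4) ℂ))) :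
    normalJet p s t f = 0 := by
  rw [← RingHom.mem_ker]
  refine Ideal.span_le.2 ?_ hf
  rintro g (rfl | rfl | rfl) <;> simp [normalJet, pow_two, RingHom.mem_ker]

/-- If `a·x + b·y` lies in `(x², x·y, y²)`, then `a` and `b` vanish everywhere. -/
theorem eval_eq_zero_of_mem_span_sq {a b : MvPolynomial (Fin 2) ℂ}
    (h : embUV a * X 0 + embUV b * X 1 ∈
      Ideal.span ({X 0 ^ 2, X 0 * X 1, X 1 ^ 2} : Set (MvPolynomial (Fin 4) ℂ)))
    (p : Fin 2 → ℂ) : eval p a = 0 ∧ eval p b = 0 := by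
  have key (s t : ℂ) : eval p a * s + eval p b * t = 0 := by
    have h0 := congrArg TrivSqZeroExt.snd (normalJet_eq_zero_of_mem_span_sq p s t h)
    rw [map_add, map_mul, map_mul, normalJet_embUV, normalJet_embUV] at h0
    simpa [normalJet, TrivSqZeroExt.algebraMap_eq_inl, mul_comm] using h0
  exact ⟨by simpa using key 1 0, by simpa using key 0 1⟩

theorem isHomogeneous_embUV_mul_add {a b : MvPolynomial (Fin 2) ℂ} {n : ℕ}
    (ha : a.IsHomogeneous n) (hb : b.IsHomogeneous n) :
    (embUV a * X 0 + embUV b * X 1).IsHomogeneous (n + 1) :=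
  (ha.rename_isHomogeneous.mul (isHomogeneous_X ℂ 0)).add
    (hb.rename_isHomogeneous.mul (isHomogeneous_X ℂ 1))

/-- The ideal `I = (a·x + b·y, x², x·y, y²)` of the double line `Z` is not generated
in degrees `≤ 3`: its homogeneous elements of degree `≤ 3` all lie in
`(x², x·y, y²)`, while `a·x + b·y` does not; in particular `I` is strictly larger
than the ideal generated by its homogeneous elements of degree at most `3`. -/
theorem double_line_ideal_not_generated_by_cubics
    (a b : MvPolynomial (Fin 2) ℂ)
    (ha : a.IsHomogeneous 3) (hb : b.IsHomogeneous 3)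
    (hab : ∀ p : Fin 2 → ℂ, p ≠ 0 → ¬(eval p a = 0 ∧ eval p b = 0)) :
    (∀ f ∈ Ideal.span {embUV a * X 0 + embUV b * X 1, X 0 ^ 2, X 0 * X 1, X 1 ^ 2},
        (∃ d ≤ 3, f.IsHomogeneous d) →
        f ∈ Ideal.span ({X 0 ^ 2, X 0 * X 1, X 1 ^ 2} :
          Set (MvPolynomial (Fin 4) ℂ))) ∧
    embUV a * X 0 + embUV b * X 1 ∉
      Ideal.span ({X 0 ^ 2, X 0 * X 1, X 1 ^ 2} : Set (MvPolynomial (Fin 4) ℂ)) ∧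
    Ideal.span {f | f ∈ Ideal.span
          {embUV a * X 0 + embUV b * X 1, X 0 ^ 2, X 0 * X 1, X 1 ^ 2} ∧
        ∃ d ≤ 3, f.IsHomogeneous d}
      < Ideal.span {embUV a * X 0 + embUV b * X 1, X 0 ^ 2, X 0 * X 1, X 1 ^ 2} := by
  have hlow : ∀ f ∈ Ideal.span {embUV a * X 0 + embUV b * X 1, X 0 ^ 2, X 0 * X 1, X 1 ^ 2},
      (∃ d ≤ 3, f.IsHomogeneous d) → f ∈ Ideal.span ({X 0 ^ 2, X 0 * X 1, X 1 ^ 2} :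
        Set (MvPolynomial (Fin 4) ℂ)) := by
    rintro f hf ⟨d, hd, hfd⟩
    obtain ⟨q, j, hj, rfl⟩ := Ideal.mem_span_insert.1 hf
    refine mem_span_sq_of_support_subset hj fun m hm => ?_
    rw [mem_support_iff] at hm ⊢
    have hdeg : m.degree = d := by
      by_contra hne
      exact hm (hfd.coeff_eq_zero hne)
    rwa [coeff_add, (isHomogeneous_embUV_mul_add ha hb).coeff_mul_eq_zero_of_degree_lt q
      (by omega), zero_add] at hm
  have hnot : embUV a * X 0 + embUV b * X 1 ∉
      Ideal.span ({X 0 ^ 2, X 0 * X 1, X 1 ^ 2} : Set (MvPolynomial (Fin 4) ℂ)) :=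
    fun h => hab 1 one_ne_zero (eval_eq_zero_of_mem_span_sq h 1)
  refine ⟨hlow, hnot, lt_of_le_of_ne (Ideal.span_le.2 fun f hf => hf.1) fun heq => hnot ?_⟩
  refine Ideal.span_le.2 (fun f hf => hlow f hf.1 hf.2) (heq.ge ?_)
  exact Ideal.subset_span (Set.mem_insert _ _)
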